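/- Let n ≥ 5, let u be a classical Schwartz solution of the energy-critical Hartree equation on a time interval I, and let a : ℝⁿ → ℝ be a smooth, compactly supported function. Define M(t) := 2 Im ∫_{ℝⁿ} ( Σ_j ∂_j a(x) ∂_{x_j} u(t,x) ) conj(u(t,x)) dx. Then for every t in the interior of I: d/dt M(t) = −∫_{ℝⁿ} Δ(Δa)(x) |u(t,x)|² dx + 4 Re ∫_{ℝⁿ} Σ_{j,k} ∂_j∂_k a(x) · ∂_{x_j} conj(u(t,x)) · ∂_{x_k} u(t,x) dx − Re ∫_{ℝⁿ}∫_{ℝⁿ} ⟪∇a(x) − ∇a(y), ∇V(x−y)⟫ |u(t,y)|² |u(t,x)|² dy dx, where ∇V(z) = −4‖z‖^{−6} z. -/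

import Mathlib

open MeasureTheory Set
open scoped RealInnerProductSpace ENNReal NNReal

noncomputable section

abbrev En (n : ℕ) := EuclideanSpace ℝ (Fin n)

/-- Spatial Laplacian of a complex-valued function. -/
def lapC {n : ℕ} (f : En n → ℂ) (x : En n) : ℂ :=
  ∑ j : Fin n, iteratedFDeriv ℝ 2 f x ![EuclideanSpace.single j 1, EuclideanSpace.single j 1]

/-- The Hartree nonlinearity potential `(V * |f|²)(x)` with `V z = ‖z‖⁻⁴`. -/
def hartreePotential {n : ℕ} (f : En n → ℂ) (x : En n) : ℝ :=
  ∫ y, (‖x - y‖ ^ 4)⁻¹ * ‖f y‖ ^ 2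

/-- A classical Schwartz solution of the energy-critical Hartree equation on `I`. -/
structure IsHartreeSolution (n : ℕ) (I : Set ℝ) (u : ℝ → En n → ℂ) : Prop where
  smooth : ContDiffOn ℝ (⊤ : ℕ∞) (fun p : ℝ × En n => u p.1 p.2) (I ×ˢ Set.univ)
  schwartz : ∀ t ∈ I, ∃ φ : SchwartzMap (En n) ℂ, ⇑φ = u t
  eqn : ∀ t ∈ I, ∀ x, Complex.I * deriv (fun s => u s x) t + lapC (u t) x
      = (hartreePotential (u t) x : ℂ) * u t x

open scoped RealInnerProductSpace

/-- Laplacian of a real-valued function. -/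
def lapR {n : ℕ} (f : En n → ℝ) (x : En n) : ℝ :=
  ∑ j : Fin n, iteratedFDeriv ℝ 2 f x ![EuclideanSpace.single j 1, EuclideanSpace.single j 1]


/-- Partial derivative in the `j`-th coordinate direction. -/
def DD {n : ℕ} {F : Type*} [NormedAddCommGroup F] [NormedSpace ℝ F] (j : Fin n) (f : En n → F)
    (x : En n) : F := fderiv ℝ f x (EuclideanSpace.single j 1)

section DDlemmas

variable {n : ℕ} {F : Type*} [NormedAddCommGroup F] [NormedSpace ℝ F]

lemma DD_smooth {f : En n → F} (hf : ContDiff ℝ (⊤ : ℕ∞) f) (j : Fin n) :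
    ContDiff ℝ (⊤ : ℕ∞) (DD j f) := by
  unfold DD
  exact (hf.fderiv_right (m := (⊤ : ℕ∞)) (by simp)).clm_apply contDiff_const

lemma DD_support {f : En n → F} (hf : HasCompactSupport f) (j : Fin n) :
    HasCompactSupport (DD j f) := hf.fderiv_apply (𝕜 := ℝ) _

lemma smooth_diff {f : En n → F} (hf : ContDiff ℝ (⊤ : ℕ∞) f) : Differentiable ℝ f :=
  hf.differentiable (by simp)

lemma iter_two {f : En n → F} (hf : ContDiff ℝ (⊤ : ℕ∞) f) (x : En n) (j k : Fin n) :
    iteratedFDeriv ℝ 2 f x ![EuclideanSpace.single j 1, EuclideanSpace.single k 1]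
      = DD j (DD k f) x := by
  rw [iteratedFDeriv_two_apply]
  unfold DD
  have h : DifferentiableAt ℝ (fderiv ℝ f) x :=
    (hf.fderiv_right (m := 1) (by norm_cast)).differentiable (by simp) x
  rw [fderiv_clm_apply h (by fun_prop)]
  simp

lemma DD_comm {f : En n → F} (hf : ContDiff ℝ (⊤ : ℕ∞) f) (j k : Fin n) (x : En n) :
    DD j (DD k f) x = DD k (DD j f) x := by
  rw [← iter_two hf, ← iter_two hf, iteratedFDeriv_two_apply, iteratedFDeriv_two_apply]
  have := (hf.contDiffAt (x := x)).isSymmSndFDerivAt (by simp; norm_cast)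
  exact this _ _

lemma DD_add {f g : En n → F} (hf : Differentiable ℝ f) (hg : Differentiable ℝ g) (j : Fin n)
    (x : En n) : DD j (fun y => f y + g y) x = DD j f x + DD j g x := by
  unfold DD
  rw [fderiv_fun_add (hf x) (hg x)]; rfl

lemma DD_mul {f g : En n → ℂ} (hf : Differentiable ℝ f) (hg : Differentiable ℝ g) (j : Fin n)
    (x : En n) : DD j (fun y => f y * g y) x = DD j f x * g x + f x * DD j g x := by
  unfold DD
  rw [fderiv_fun_mul (hf x) (hg x)]; simp; ring

lemma DD_mulR {f g : En n → ℝ} (hf : Differentiable ℝ f) (hg : Differentiable ℝ g) (j : Fin n)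
    (x : En n) : DD j (fun y => f y * g y) x = DD j f x * g x + f x * DD j g x := by
  unfold DD
  rw [fderiv_fun_mul (hf x) (hg x)]; simp; ring

lemma DD_cmul {f : En n → ℂ} (hf : Differentiable ℝ f) (c : ℂ) (j : Fin n)
    (x : En n) : DD j (fun y => c * f y) x = c * DD j f x := by
  unfold DD
  rw [fderiv_const_mul (hf x)]; simp

lemma DD_sum {ι : Type*} (s : Finset ι) {f : ι → En n → F} (hf : ∀ i, Differentiable ℝ (f i))
    (j : Fin n) (x : En n) : DD j (fun y => ∑ i ∈ s, f i y) x = ∑ i ∈ s, DD j (f i) x := by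
  unfold DD
  rw [fderiv_fun_sum (fun i _ => hf i x)]; simp

lemma DD_conj {f : En n → ℂ} (hf : Differentiable ℝ f) (j : Fin n) (x : En n) :
    DD j (fun y => (starRingEnd ℂ) (f y)) x = (starRingEnd ℂ) (DD j f x) := by
  unfold DD
  have := (Complex.conjCLE.toContinuousLinearMap.hasFDerivAt.comp x (hf x).hasFDerivAt).fderiv
  have h2 : (fun y => (starRingEnd ℂ) (f y)) = Complex.conjCLE.toContinuousLinearMap ∘ f := by
    ext; simp
  rw [h2, this]; simp

lemma DD_ofReal {f : En n → ℝ} (hf : Differentiable ℝ f) (j : Fin n) (x : En n) :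
    DD j (fun y => (f y : ℂ)) x = ((DD j f x : ℝ) : ℂ) := by
  unfold DD
  have := (Complex.ofRealCLM.hasFDerivAt.comp x (hf x).hasFDerivAt).fderiv
  have h2 : (fun y => (f y : ℂ)) = Complex.ofRealCLM ∘ f := by
    ext; simp
  rw [h2, this]; simp

lemma smooth_ofReal {f : En n → ℝ} (hf : ContDiff ℝ (⊤ : ℕ∞) f) :
    ContDiff ℝ (⊤ : ℕ∞) (fun y => (f y : ℂ)) := Complex.ofRealCLM.contDiff.comp hf

lemma smooth_conj {f : En n → ℂ} (hf : ContDiff ℝ (⊤ : ℕ∞) f) :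
    ContDiff ℝ (⊤ : ℕ∞) (fun y => (starRingEnd ℂ) (f y)) :=
  Complex.conjCLE.toContinuousLinearMap.contDiff.comp hf

lemma integrable_smooth {f : En n → F} (hf : ContDiff ℝ (⊤ : ℕ∞) f) (hc : HasCompactSupport f) :
    Integrable f := hf.continuous.integrable_of_hasCompactSupport hc

lemma integral_DD_zero {f : En n → ℂ} (hf : ContDiff ℝ (⊤ : ℕ∞) f) (hc : HasCompactSupport f)
    (j : Fin n) : ∫ x, DD j f x = 0 := by
  have := integral_mul_fderiv_eq_neg_fderiv_mul_of_integrable (μ := (volume : Measure (En n)))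
    (f := fun _ => (1 : ℂ)) (g := f)
    (v := EuclideanSpace.single j 1) (by simp)
    (by simpa [DD] using! integrable_smooth (DD_smooth hf j) (DD_support hc j))
    (by simpa using integrable_smooth hf hc) (fun x _ => by fun_prop)
    (fun x _ => smooth_diff hf x)
  simpa [DD] using this

end DDlemmas

section Linear

variable {n : ℕ}

lemma linear_pair {A u v : En n → ℂ} (hA : ContDiff ℝ (⊤ : ℕ∞) A) (hAc : HasCompactSupport A)
    (hu : ContDiff ℝ (⊤ : ℕ∞) u) (hv : ContDiff ℝ (⊤ : ℕ∞) v) (j k : Fin n) :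
    ∃ f : En n → ℂ, Integrable f ∧ ∫ x, f x = 0 ∧ ∀ x,
      (-DD j (DD j A) x * (DD k (DD k u) x * v x + DD k (DD k v) x * u x)
        - 2 * (DD j A x * (DD j u x * DD k (DD k v) x + DD j v x * DD k (DD k u) x)))
      = (- DD k (DD k (DD j (DD j A))) x * (u x * v x)
        + 2 * (DD j (DD k A) x * (DD j v x * DD k u x + DD j u x * DD k v x))) + f x := by
  have hAj := DD_smooth hA j
  have hAjj := DD_smooth hAj j
  have hAjjk := DD_smooth hAjj k
  have huj := DD_smooth hu j
  have huk := DD_smooth hu k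
  have hvj := DD_smooth hv j
  have hvk := DD_smooth hv k
  have cAj := DD_support hAc j
  have cAjj := DD_support cAj j
  have cAjjk := DD_support cAjj k
  have dAj := smooth_diff hAj
  have dAjj := smooth_diff hAjj
  have dAjjk := smooth_diff hAjjk
  have du := smooth_diff hu
  have dv := smooth_diff hv
  have duj := smooth_diff huj
  have duk := smooth_diff huk
  have dvj := smooth_diff hvj
  have dvk := smooth_diff hvk
  set F : En n → ℂ := fun x => (-1) * (DD j (DD j A) x * (DD k u x * v x + u x * DD k v x))
    + (DD k (DD j (DD j A)) x * (u x * v x)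
      + (-2) * (DD j A x * (DD j u x * DD k v x + DD j v x * DD k u x))) with hF
  set G : En n → ℂ := fun x => 2 * (DD j A x * (DD k u x * DD k v x)) with hG
  have sF : ContDiff ℝ (⊤ : ℕ∞) F := by
    rw [hF]; fun_prop
  have sG : ContDiff ℝ (⊤ : ℕ∞) G := by
    rw [hG]; fun_prop
  have cF : HasCompactSupport F :=
    (HasCompactSupport.mul_left cAjj.mul_right).add
      (cAjjk.mul_right.add (HasCompactSupport.mul_left cAj.mul_right))
  have cG : HasCompactSupport G := HasCompactSupport.mul_left cAj.mul_right
  have iF := integrable_smooth (DD_smooth sF k) (DD_support cF k)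
  have iG := integrable_smooth (DD_smooth sG j) (DD_support cG j)
  refine ⟨fun x => DD k F x + DD j G x, iF.add iG, ?_, ?_⟩
  · rw [integral_add iF iG, integral_DD_zero sF cF, integral_DD_zero sG cG, add_zero]
  · intro x
    rw [hF, hG]
    beta_reduce
    rw [DD_add (by fun_prop) (by fun_prop), DD_add (by fun_prop) (by fun_prop),
      DD_cmul (by fun_prop), DD_cmul (by fun_prop), DD_cmul (by fun_prop),
      DD_mul (by fun_prop) (by fun_prop), DD_mul (by fun_prop) (by fun_prop),
      DD_mul (by fun_prop) (by fun_prop), DD_mul (by fun_prop) (by fun_prop),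
      DD_mul (by fun_prop) (by fun_prop), DD_mul (by fun_prop) (by fun_prop),
      DD_add (by fun_prop) (by fun_prop), DD_add (by fun_prop) (by fun_prop),
      DD_mul (by fun_prop) (by fun_prop), DD_mul (by fun_prop) (by fun_prop),
      DD_mul (by fun_prop) (by fun_prop), DD_mul (by fun_prop) (by fun_prop),
      DD_comm hA k j, DD_comm hu k j, DD_comm hv k j]
    ring

/-- The linear part of the virial identity, in bilinear form. -/
lemma linear_part {A u v : En n → ℂ} (hA : ContDiff ℝ (⊤ : ℕ∞) A) (hAc : HasCompactSupport A)
    (hu : ContDiff ℝ (⊤ : ℕ∞) u) (hv : ContDiff ℝ (⊤ : ℕ∞) v) :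
    ∃ f : En n → ℂ, Integrable f ∧ ∫ x, f x = 0 ∧ ∀ x,
      (-(∑ j, DD j (DD j A) x) * ((∑ k, DD k (DD k u) x) * v x + (∑ k, DD k (DD k v) x) * u x)
        - 2 * (∑ j, DD j A x * (DD j u x * (∑ k, DD k (DD k v) x)
            + DD j v x * (∑ k, DD k (DD k u) x))))
      = (- (∑ k, DD k (DD k (fun y => ∑ j, DD j (DD j A) y)) x) * (u x * v x)
        + 4 * (∑ j, ∑ k, DD j (DD k A) x * DD j v x * DD k u x)) + f x := by
  choose f hfi hf0 hfe using fun j k => linear_pair hA hAc hu hv j k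
  refine ⟨fun x => ∑ j, ∑ k, f j k x, ?_, ?_, ?_⟩
  · exact integrable_finsetSum _ fun j _ => integrable_finsetSum _ fun k _ => hfi j k
  · rw [integral_finsetSum _ fun j _ => integrable_finsetSum _ fun k _ => hfi j k]
    refine Finset.sum_eq_zero fun j _ => ?_
    rw [integral_finsetSum _ fun k _ => hfi j k]
    exact Finset.sum_eq_zero fun k _ => hf0 j k
  · intro x
    have h1 : (∑ k, DD k (DD k (fun y => ∑ j, DD j (DD j A) y)) x)
        = ∑ j, ∑ k, DD k (DD k (DD j (DD j A))) x := by
      rw [Finset.sum_comm]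
      refine Finset.sum_congr rfl fun k _ => ?_
      have : DD k (fun y => ∑ j, DD j (DD j A) y) = fun y => ∑ j, DD k (DD j (DD j A)) y := by
        ext y
        exact DD_sum _ (fun j => smooth_diff (DD_smooth (DD_smooth hA j) j)) k y
      rw [this]
      exact DD_sum _ (fun j => smooth_diff (DD_smooth (DD_smooth (DD_smooth hA j) j) k)) k x
    have h2 : ∑ j, ∑ k, DD j (DD k A) x * DD j v x * DD k u x
        = ∑ j, ∑ k, DD j (DD k A) x * DD j u x * DD k v x := by
      rw [Finset.sum_comm]
      refine Finset.sum_congr rfl fun k _ => Finset.sum_congr rfl fun j _ => ?_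
      rw [DD_comm hA k j]; ring
    have h3 : 4 * (∑ j, ∑ k, DD j (DD k A) x * DD j v x * DD k u x)
       = ∑ j, ∑ k, 2 * (DD j (DD k A) x * (DD j v x * DD k u x + DD j u x * DD k v x)) := by
      have : (4 : ℂ) * (∑ j, ∑ k, DD j (DD k A) x * DD j v x * DD k u x)
        = 2 * (∑ j, ∑ k, DD j (DD k A) x * DD j v x * DD k u x)
        + 2 * (∑ j, ∑ k, DD j (DD k A) x * DD j u x * DD k v x) := by rw [← h2]; ring
      rw [this]
      simp only [Finset.mul_sum, ← Finset.sum_add_distrib]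
      refine Finset.sum_congr rfl fun k _ => Finset.sum_congr rfl fun j _ => ?_
      ring
    rw [h1, h3]
    have h4 := Finset.sum_congr rfl (fun j (_ : j ∈ Finset.univ) =>
      Finset.sum_congr rfl (fun k (_ : k ∈ Finset.univ) => hfe j k x))
    simp only [Finset.sum_add_distrib, Finset.sum_sub_distrib] at h4
    convert h4 using 1
    · congr 1
      · simp only [← Finset.mul_sum, ← Finset.sum_mul, Finset.sum_add_distrib,
          Finset.sum_neg_distrib]
      · simp only [← Finset.mul_sum, ← Finset.sum_mul, Finset.sum_add_distrib]
    · simp only [← Finset.mul_sum, ← Finset.sum_mul, Finset.sum_add_distrib,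
          Finset.sum_neg_distrib]

end Linear

section Nonlinear

variable {n : ℕ}

lemma kernel_integrable (hn : 5 ≤ n) {ρ g : En n → ℝ} {C : ℝ} (hρ : Integrable ρ)
    (hg : Integrable g) (hgC : ∀ x, ‖g x‖ ≤ C) :
    Integrable (fun p : En n × En n => (‖p.1 - p.2‖ ^ 4)⁻¹ * ρ p.2 * g p.1)
      (volume.prod volume) := by
  set V : En n → ℝ := fun z => (‖z‖ ^ 4)⁻¹ with hV
  have hVm : Measurable V := by rw [hV]; fun_prop
  set B : Set (En n) := Metric.ball 0 1 with hB
  have hBm : MeasurableSet B := Metric.isOpen_ball.measurableSet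
  have h1 : Integrable (B.indicator V) := by
    rw [integrable_indicator_iff hBm]
    refine integrableOn_ball_of_norm_le_rpow (C := 1) (α := 4) ?_ ?_ ?_ hVm.aestronglyMeasurable
    · simp; omega
    · simp; exact_mod_cast (by omega : 4 < n)
    · filter_upwards with x
      rw [hV, one_mul, Real.rpow_neg (norm_nonneg _)]
      rw [Real.norm_of_nonneg (by positivity)]
      norm_cast
  have h2 : ∀ z, ‖Bᶜ.indicator V z‖ ≤ 1 := by
    intro z
    by_cases hz : z ∈ B
    · simp [hz]
    · rw [indicator_of_mem (by simpa using hz), hV, Real.norm_of_nonneg (by positivity)]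
      have : 1 ≤ ‖z‖ := by simpa [hB] using hz
      exact inv_le_one_of_one_le₀ (one_le_pow₀ this)
  have i1 := (hρ.convolution_integrand (ContinuousLinearMap.mul ℝ ℝ) h1).mul_bdd (c := C)
    (g := fun p : En n × En n => g p.1) (hg.aestronglyMeasurable.comp_fst)
    (Filter.Eventually.of_forall fun p => hgC p.1)
  have i2 := (hg.mul_prod hρ).bdd_mul (c := 1)
    (f := fun p : En n × En n => Bᶜ.indicator V (p.1 - p.2))
    (((hVm.indicator hBm.compl).comp (measurable_fst.sub measurable_snd)).aestronglyMeasurable)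
    (Filter.Eventually.of_forall fun p => h2 _)
  refine (i1.add i2).congr (Filter.Eventually.of_forall fun p => ?_)
  have : V (p.1 - p.2) = B.indicator V (p.1 - p.2) + Bᶜ.indicator V (p.1 - p.2) := by
    rw [← Pi.add_apply, indicator_self_add_compl]
  simp only [Pi.add_apply, ContinuousLinearMap.mul_apply']
  change _ = V (p.1 - p.2) * ρ p.2 * g p.1
  rw [this]; ring

lemma diag_ae (hn : 5 ≤ n) :
    ∀ᵐ p : En n × En n ∂(volume.prod volume), p.1 ≠ p.2 := by
  have : Nonempty (Fin n) := ⟨⟨0, by omega⟩⟩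
  have hm : MeasurableSet {p : En n × En n | p.1 = p.2} :=
    (isClosed_eq continuous_fst continuous_snd).measurableSet
  have : (volume.prod volume) {p : En n × En n | p.1 = p.2} = 0 := by
    rw [Measure.measure_prod_null hm]
    refine Filter.Eventually.of_forall fun x => ?_
    have : Prod.mk x ⁻¹' {p : En n × En n | p.1 = p.2} = {x} := by
      ext y; simp [eq_comm]
    beta_reduce
    rw [this]; simp
  rw [ae_iff]
  simpa using this

/-- Regularised kernel. -/
def Veps (e : ℝ) (z : En n) : ℝ := ((‖z‖ ^ 2 + e) ^ 2)⁻¹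

lemma Veps_hasFDerivAt {e : ℝ} (he : 0 < e) (y x : En n) :
    HasFDerivAt (fun x => Veps e (x - y))
      ((-4 * ((‖x - y‖ ^ 2 + e) ^ 3)⁻¹) • innerSL ℝ (x - y)) x := by
  have h0 : HasFDerivAt (fun x : En n => ‖x - y‖ ^ 2 + e) (2 • innerSL ℝ (x - y)) x := by
    have := ((hasFDerivAt_id x).sub_const y).norm_sq
    refine (this.add_const e).congr_fderiv ?_
    ext; simp
  have hpos : 0 < ‖x - y‖ ^ 2 + e := by positivity
  have h1 : HasDerivAt (fun s : ℝ => (s ^ 2)⁻¹) (-2 * ((‖x - y‖ ^ 2 + e) ^ 3)⁻¹)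
      (‖x - y‖ ^ 2 + e) := by
    have := (hasDerivAt_pow 2 (‖x - y‖ ^ 2 + e)).inv (by positivity)
    refine this.congr_deriv ?_
    field_simp
    norm_num
    ring
  refine (h1.comp_hasFDerivAt x h0).congr_fderiv ?_
  ext z
  simp; ring

lemma fderiv_sum_coord (a : En n → ℝ) (x z : En n) :
    fderiv ℝ a x z = ∑ j, z j * DD j a x := by
  conv_lhs => rw [← (EuclideanSpace.basisFun (Fin n) ℝ).sum_repr z]
  simp [DD]

/-- Integration by parts in `x` with the regularised kernel. -/
lemma eps_ibp {e : ℝ} (he : 0 < e) {a ρ : En n → ℝ} (ha : ContDiff ℝ (⊤ : ℕ∞) a)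
    (hac : HasCompactSupport a) (hρ : ContDiff ℝ (⊤ : ℕ∞) ρ) (y : En n) :
    ∫ x, Veps e (x - y) * (∑ j, DD j (fun z => DD j a z * ρ z) x)
      = - ∫ x, (-4 * ((‖x - y‖ ^ 2 + e) ^ 3)⁻¹) * fderiv ℝ a x (x - y) * ρ x := by
  have hφd : ∀ j x, DD j (fun x => Veps e (x - y)) x
      = (-4 * ((‖x - y‖ ^ 2 + e) ^ 3)⁻¹) * (x - y) j := by
    intro j x
    unfold DD
    rw [(Veps_hasFDerivAt he y x).fderiv]
    simp [EuclideanSpace.inner_single_right]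
  have hpos : ∀ x : En n, (‖x - y‖ ^ 2 + e) ≠ 0 := fun x => by positivity
  have hφc : Continuous (fun x => Veps e (x - y)) := by
    unfold Veps
    exact Continuous.inv₀ (by fun_prop) (fun x => pow_ne_zero _ (hpos x))
  have hφ'c : ∀ j, Continuous (DD j (fun x => Veps e (x - y))) := by
    intro j
    have : DD j (fun x => Veps e (x - y)) = _ := funext (hφd j)
    rw [this]
    exact (continuous_const.mul (Continuous.inv₀ (by fun_prop)
      (fun x => pow_ne_zero _ (hpos x)))).mul (by fun_prop)
  have hh : ∀ j, ContDiff ℝ (⊤ : ℕ∞) (fun z => DD j a z * ρ z) :=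
    fun j => (DD_smooth ha j).mul hρ
  have hhc : ∀ j, HasCompactSupport (fun z => DD j a z * ρ z) :=
    fun j => (DD_support hac j).mul_right
  have I1 : ∀ j, Integrable (fun x => Veps e (x - y) * DD j (fun z => DD j a z * ρ z) x) :=
    fun j => (hφc.mul (DD_smooth (hh j) j).continuous).integrable_of_hasCompactSupport
      (DD_support (hhc j) j).mul_left
  have I2 : ∀ j, Integrable (fun x => DD j (fun x => Veps e (x - y)) x * (DD j a x * ρ x)) :=
    fun j => ((hφ'c j).mul (hh j).continuous).integrable_of_hasCompactSupport
      (hhc j).mul_left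
  have I3 : ∀ j, Integrable (fun x => Veps e (x - y) * (DD j a x * ρ x)) :=
    fun j => (hφc.mul (hh j).continuous).integrable_of_hasCompactSupport
      (hhc j).mul_left
  have key : ∀ j, ∫ x, Veps e (x - y) * DD j (fun z => DD j a z * ρ z) x
      = - ∫ x, DD j (fun x => Veps e (x - y)) x * (DD j a x * ρ x) := fun j =>
    integral_mul_fderiv_eq_neg_fderiv_mul_of_integrable (I2 j) (I1 j) (I3 j)
      (fun x _ => (Veps_hasFDerivAt he y x).differentiableAt)
      (fun x _ => smooth_diff (hh j) x)
  simp_rw [Finset.mul_sum]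
  rw [integral_finsetSum _ fun j _ => I1 j]
  simp_rw [key]
  rw [Finset.sum_neg_distrib, ← integral_finsetSum _ fun j _ => I2 j]
  congr 1
  refine integral_congr_ae (Filter.Eventually.of_forall fun x => ?_)
  simp only [hφd]
  rw [fderiv_sum_coord, Finset.mul_sum, Finset.sum_mul]
  refine Finset.sum_congr rfl fun j _ => ?_
  ring

lemma bdd_of_cs {F : Type*} [NormedAddCommGroup F] {f : En n → F} (hf : Continuous f)
    (hc : HasCompactSupport f) : ∃ C, ∀ x, ‖f x‖ ≤ C := hf.bounded_above_of_compact_support hc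

/-- Symmetrised identity with the regularised kernel. -/
lemma eps_identity {e : ℝ} (he : 0 < e) {a ρ : En n → ℝ} (ha : ContDiff ℝ (⊤ : ℕ∞) a)
    (hac : HasCompactSupport a) (hρ : ContDiff ℝ (⊤ : ℕ∞) ρ) (hρi : Integrable ρ) :
    2 * ∫ p : En n × En n, Veps e (p.1 - p.2) * ρ p.2 * (∑ j, DD j (fun z => DD j a z * ρ z) p.1)
        ∂(volume.prod volume)
      = - ∫ p : En n × En n, (-4 * ((‖p.1 - p.2‖ ^ 2 + e) ^ 3)⁻¹) *
        (fderiv ℝ a p.1 (p.1 - p.2) - fderiv ℝ a p.2 (p.1 - p.2)) * ρ p.2 * ρ p.1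
        ∂(volume.prod volume) := by
  have hpos : ∀ z : En n, (‖z‖ ^ 2 + e) ≠ 0 := fun x => by positivity
  set g : En n → ℝ := fun x => ∑ j, DD j (fun z => DD j a z * ρ z) x with hg
  have hh : ∀ j, ContDiff ℝ (⊤ : ℕ∞) (fun z => DD j a z * ρ z) :=
    fun j => (DD_smooth ha j).mul hρ
  have hhc : ∀ j, HasCompactSupport (fun z => DD j a z * ρ z) :=
    fun j => (DD_support hac j).mul_right
  have gi : Integrable g := integrable_finsetSum _ fun j _ =>
    integrable_smooth (DD_smooth (hh j) j) (DD_support (hhc j) j)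
  have hVc : Continuous (Veps e : En n → ℝ) := by
    unfold Veps
    exact Continuous.inv₀ (by fun_prop) (fun x => pow_ne_zero _ (hpos x))
  have hVb : ∀ z : En n, ‖Veps e z‖ ≤ (e ^ 2)⁻¹ := by
    intro z
    unfold Veps
    rw [Real.norm_of_nonneg (by positivity)]
    gcongr
    nlinarith [sq_nonneg ‖z‖]
  have hP : Integrable (fun p : En n × En n => Veps e (p.1 - p.2) * ρ p.2 * g p.1)
      (volume.prod volume) := by
    have := (gi.mul_prod hρi).bdd_mul (c := (e ^ 2)⁻¹)
      (f := fun p : En n × En n => Veps e (p.1 - p.2))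
      (by exact (hVc.comp (by fun_prop)).aestronglyMeasurable)
      (Filter.Eventually.of_forall fun p => hVb _)
    refine this.congr (Filter.Eventually.of_forall fun p => ?_)
    simp only; ring
  have hda : Continuous (fderiv ℝ a) := ha.continuous_fderiv (by simp)
  obtain ⟨C, hC⟩ := bdd_of_cs hda (hac.fderiv (𝕜 := ℝ))
  set q : En n × En n → ℝ := fun p => (-4 * ((‖p.1 - p.2‖ ^ 2 + e) ^ 3)⁻¹) *
    fderiv ℝ a p.1 (p.1 - p.2) with hq
  have hqc : Continuous q := by
    rw [hq]
    refine (continuous_const.mul (Continuous.inv₀ (by fun_prop)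
      (fun x => pow_ne_zero _ (hpos _)))).mul ?_
    exact (hda.comp continuous_fst).clm_apply (by fun_prop)
  have hqb : ∀ p, ‖q p‖ ≤ 4 * C * ((e ^ 3)⁻¹ + (e ^ 2)⁻¹) := by
    intro p
    rw [hq]
    simp only [norm_mul, norm_neg, norm_inv, norm_pow]
    set r := ‖p.1 - p.2‖ with hr
    have hr0 : 0 ≤ r := norm_nonneg _
    have h1 : ‖fderiv ℝ a p.1 (p.1 - p.2)‖ ≤ C * r :=
      ((fderiv ℝ a p.1).le_opNorm _).trans (by gcongr; exact hC _)
    have hC0 : 0 ≤ C := (norm_nonneg _).trans (hC p.1)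
    have h2 : ((‖r ^ 2 + e‖) ^ 3)⁻¹ * r ≤ (e ^ 3)⁻¹ + (e ^ 2)⁻¹ := by
      rw [Real.norm_of_nonneg (by positivity)]
      have h3 : ((r ^ 2 + e) ^ 3)⁻¹ ≤ (e ^ 3)⁻¹ := by
        gcongr; nlinarith
      have h5 : ((r ^ 2 + e) ^ 3)⁻¹ * r ^ 2 ≤ (e ^ 2)⁻¹ := by
        have : ((r ^ 2 + e) ^ 3)⁻¹ * r ^ 2 ≤ ((r ^ 2 + e) ^ 2)⁻¹ := by
          rw [inv_mul_le_iff₀ (by positivity)]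
          have : (r ^ 2 + e) ^ 3 * ((r ^ 2 + e) ^ 2)⁻¹ = r ^ 2 + e := by field_simp
          rw [this]; linarith
        refine this.trans ?_
        gcongr; nlinarith
      have h6 : r ≤ 1 + r ^ 2 := by nlinarith [sq_nonneg (r - 1)]
      calc ((r ^ 2 + e) ^ 3)⁻¹ * r ≤ ((r ^ 2 + e) ^ 3)⁻¹ * (1 + r ^ 2) := by gcongr
        _ = ((r ^ 2 + e) ^ 3)⁻¹ + ((r ^ 2 + e) ^ 3)⁻¹ * r ^ 2 := by ring
        _ ≤ _ := by gcongr
    have h4 : ‖(4 : ℝ)‖ = 4 := by norm_num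
    rw [h4]
    calc 4 * (‖r ^ 2 + e‖ ^ 3)⁻¹ * ‖fderiv ℝ a p.1 (p.1 - p.2)‖
        ≤ 4 * (‖r ^ 2 + e‖ ^ 3)⁻¹ * (C * r) := by gcongr
      _ = 4 * C * ((‖r ^ 2 + e‖ ^ 3)⁻¹ * r) := by ring
      _ ≤ _ := by gcongr
  have hQ : Integrable (fun p : En n × En n => q p * ρ p.2 * ρ p.1) (volume.prod volume) := by
    have := (hρi.mul_prod hρi).bdd_mul
      (f := q) hqc.aestronglyMeasurable
      (Filter.Eventually.of_forall hqb)
    refine this.congr (Filter.Eventually.of_forall fun p => ?_)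
    simp only; ring
  have e1 : ∫ p, Veps e (p.1 - p.2) * ρ p.2 * g p.1 ∂(volume.prod volume)
      = - ∫ p, q p * ρ p.2 * ρ p.1 ∂(volume.prod volume) := by
    rw [integral_prod_symm _ hP, integral_prod_symm _ hQ, ← integral_neg]
    refine integral_congr_ae (Filter.Eventually.of_forall fun y => ?_)
    have := eps_ibp he ha hac hρ y
    calc ∫ x, Veps e (x - y) * ρ y * g x = ∫ x, ρ y * (Veps e (x - y) * g x) := by
          congr 1; ext x; ring
      _ = ρ y * ∫ x, Veps e (x - y) * g x := integral_const_mul _ _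
      _ = - (ρ y * ∫ x, q (x, y) * ρ x) := by rw [this]; ring
      _ = - ∫ x, ρ y * (q (x, y) * ρ x) := by rw [integral_const_mul]
      _ = _ := by congr 2; ext x; ring
  have e2 : ∫ p, q p.swap * ρ p.1 * ρ p.2 ∂(volume.prod volume)
      = ∫ p, q p * ρ p.2 * ρ p.1 ∂(volume.prod volume) :=
    integral_prod_swap (fun p : En n × En n => q p * ρ p.2 * ρ p.1)
  have hQ' : Integrable (fun p : En n × En n => q p.swap * ρ p.1 * ρ p.2)
    (volume.prod volume) := hQ.swap
  have e3 : (2 : ℝ) * ∫ p, Veps e (p.1 - p.2) * ρ p.2 * g p.1 ∂(volume.prod volume)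
     = - ((∫ p, q p * ρ p.2 * ρ p.1 ∂(volume.prod volume)) +
        ∫ p, q p.swap * ρ p.1 * ρ p.2 ∂(volume.prod volume)) := by rw [e1, e2]; ring
  rw [e3, ← integral_add hQ hQ']
  congr 1
  refine integral_congr_ae (Filter.Eventually.of_forall fun p => ?_)
  simp only [hq, Prod.fst_swap, Prod.snd_swap]
  rw [norm_sub_rev p.2 p.1, ← neg_sub p.1 p.2, map_neg]
  ring

open Filter Topology in
lemma nonlinear_part (hn : 5 ≤ n) {a ρ : En n → ℝ} {C : ℝ} (ha : ContDiff ℝ (⊤ : ℕ∞) a)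
    (hac : HasCompactSupport a) (hρ : ContDiff ℝ (⊤ : ℕ∞) ρ) (hρi : Integrable ρ)
    (hρC : ∀ x, ‖ρ x‖ ≤ C) :
    Integrable (fun x => (∫ y, (‖x - y‖ ^ 4)⁻¹ * ρ y) *
        (∑ j, DD j (fun z => DD j a z * ρ z) x)) ∧
    2 * ∫ x, (∫ y, (‖x - y‖ ^ 4)⁻¹ * ρ y) * (∑ j, DD j (fun z => DD j a z * ρ z) x)
      = - ∫ x, ∫ y, ⟪gradient a x - gradient a y, (-4 * (‖x - y‖ ^ 6)⁻¹) • (x - y)⟫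
          * ρ y * ρ x := by
  set g : En n → ℝ := fun x => ∑ j, DD j (fun z => DD j a z * ρ z) x with hg
  have hh : ∀ j, ContDiff ℝ (⊤ : ℕ∞) (fun z => DD j a z * ρ z) :=
    fun j => (DD_smooth ha j).mul hρ
  have hhc : ∀ j, HasCompactSupport (fun z => DD j a z * ρ z) :=
    fun j => (DD_support hac j).mul_right
  have gi : Integrable g := integrable_finsetSum _ fun j _ =>
    integrable_smooth (DD_smooth (hh j) j) (DD_support (hhc j) j)
  have gc : Continuous g := continuous_finsetSum _ fun j _ => (DD_smooth (hh j) j).continuous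
  choose B hB using fun j => bdd_of_cs (DD_smooth (hh j) j).continuous (DD_support (hhc j) j)
  have gB : ∀ x, ‖g x‖ ≤ ∑ j, B j := fun x =>
    (norm_sum_le _ _).trans (Finset.sum_le_sum fun j _ => hB j x)
  have hP := kernel_integrable hn hρi gi gB
  have hR := (kernel_integrable hn hρi hρi hρC)
  have hda : Continuous (fderiv ℝ a) := ha.continuous_fderiv (by simp)
  obtain ⟨L, hL⟩ := (ha.fderiv_right (m := 1) (by norm_cast)).lipschitzWith_of_hasCompactSupport
    (hac.fderiv (𝕜 := ℝ)) (by simp)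
  have hL' : ∀ x y : En n, |fderiv ℝ a x (x - y) - fderiv ℝ a y (x - y)| ≤ L * ‖x - y‖ ^ 2 := by
    intro x y
    have h1 := (fderiv ℝ a x - fderiv ℝ a y).le_opNorm (x - y)
    have h2 := hL.dist_le_mul x y
    rw [dist_eq_norm, dist_eq_norm] at h2
    calc |fderiv ℝ a x (x - y) - fderiv ℝ a y (x - y)|
        ≤ ‖fderiv ℝ a x - fderiv ℝ a y‖ * ‖x - y‖ := by simpa using h1
      _ ≤ (L * ‖x - y‖) * ‖x - y‖ := by gcongr
      _ = _ := by ring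
  -- pointwise bounds off the diagonal
  set e : ℕ → ℝ := fun m => 1 / ((m : ℝ) + 1) with he
  have hepos : ∀ m, 0 < e m := fun m => by rw [he]; positivity
  have helim : Tendsto e atTop (𝓝 0) := tendsto_one_div_add_atTop_nhds_zero_nat
  set K : En n × En n → ℝ := fun p => (-4 * (‖p.1 - p.2‖ ^ 6)⁻¹) *
        (fderiv ℝ a p.1 (p.1 - p.2) - fderiv ℝ a p.2 (p.1 - p.2)) * ρ p.2 * ρ p.1 with hK
  have fcont : Continuous (fun p : En n × En n =>
      fderiv ℝ a p.1 (p.1 - p.2) - fderiv ℝ a p.2 (p.1 - p.2)) :=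
    ((hda.comp continuous_fst).clm_apply (by fun_prop)).sub
      ((hda.comp continuous_snd).clm_apply (by fun_prop))
  have ρc := hρ.continuous
  have kbound : ∀ (r s F : ℝ), 0 < r → r ^ 6 ≤ s → |F| ≤ L * r ^ 2 → ∀ p : En n × En n,
      ‖(-4 * s⁻¹) * F * ρ p.2 * ρ p.1‖ ≤ 4 * L * ‖(r ^ 4)⁻¹ * ρ p.2 * ρ p.1‖ := by
    intro r s F hr hs hF p
    simp only [norm_mul, norm_neg, norm_inv, norm_pow]
    have h4 : ‖(4 : ℝ)‖ = 4 := by norm_num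
    have hs0 : 0 < s := lt_of_lt_of_le (by positivity) hs
    rw [h4, Real.norm_of_nonneg hs0.le, Real.norm_of_nonneg hr.le]
    have h5 : s⁻¹ * ‖F‖ ≤ L * (r ^ 4)⁻¹ := by
      calc s⁻¹ * ‖F‖ ≤ (r ^ 6)⁻¹ * (L * r ^ 2) := by
            gcongr; exact hF
        _ = _ := by field_simp
    calc 4 * s⁻¹ * ‖F‖ * ‖ρ p.2‖ * ‖ρ p.1‖ = 4 * (s⁻¹ * ‖F‖) * ‖ρ p.2‖ * ‖ρ p.1‖ := by ring
      _ ≤ 4 * (L * (r ^ 4)⁻¹) * ‖ρ p.2‖ * ‖ρ p.1‖ := by gcongr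
      _ = _ := by ring
  have hKi : Integrable K (volume.prod volume) := by
    refine (hR.norm.const_mul (4 * L)).mono' ?_ ?_
    · have m1 : Measurable (fun p : En n × En n => (-4 * (‖p.1 - p.2‖ ^ 6)⁻¹)) := by fun_prop
      exact (((m1.mul fcont.measurable).mul (ρc.measurable.comp measurable_snd)).mul
        (ρc.measurable.comp measurable_fst)).aestronglyMeasurable
    · filter_upwards [diag_ae hn] with p hp
      exact kbound _ _ _ (norm_pos_iff.2 (sub_ne_zero.2 hp)) le_rfl (hL' _ _) p
  have lim1 : Tendsto (fun m => ∫ p : En n × En n, Veps (e m) (p.1 - p.2) * ρ p.2 * g p.1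
      ∂(volume.prod volume)) atTop
      (𝓝 (∫ p : En n × En n, (‖p.1 - p.2‖ ^ 4)⁻¹ * ρ p.2 * g p.1 ∂(volume.prod volume))) := by
    refine tendsto_integral_of_dominated_convergence _ (fun m => ?_) hP.norm (fun m => ?_) ?_
    · have m1 : Measurable (fun p : En n × En n => Veps (e m) (p.1 - p.2)) := by
        unfold Veps; fun_prop
      exact ((m1.mul (ρc.measurable.comp measurable_snd)).mul
        (gc.measurable.comp measurable_fst)).aestronglyMeasurable
    · filter_upwards [diag_ae hn] with p hp
      have hr := norm_pos_iff.2 (sub_ne_zero.2 hp)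
      have := hepos m
      rw [norm_mul, norm_mul, norm_mul, norm_mul]
      gcongr
      unfold Veps
      rw [Real.norm_of_nonneg (by positivity), Real.norm_of_nonneg (by positivity)]
      gcongr
      nlinarith [sq_nonneg ‖p.1 - p.2‖]
    · filter_upwards [diag_ae hn] with p hp
      have hr := norm_pos_iff.2 (sub_ne_zero.2 hp)
      refine Tendsto.mul_const _ (Tendsto.mul_const _ ?_)
      unfold Veps
      have : (‖p.1 - p.2‖ ^ 4)⁻¹ = ((‖p.1 - p.2‖ ^ 2 + 0) ^ 2)⁻¹ := by ring
      rw [this]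
      exact ((helim.const_add _).pow 2).inv₀ (by positivity)
  have lim2 : Tendsto (fun m => ∫ p : En n × En n, (-4 * ((‖p.1 - p.2‖ ^ 2 + e m) ^ 3)⁻¹) *
        (fderiv ℝ a p.1 (p.1 - p.2) - fderiv ℝ a p.2 (p.1 - p.2)) * ρ p.2 * ρ p.1
      ∂(volume.prod volume)) atTop (𝓝 (∫ p, K p ∂(volume.prod volume))) := by
    refine tendsto_integral_of_dominated_convergence _ (fun m => ?_) (hR.norm.const_mul (4 * L))
      (fun m => ?_) ?_
    · have m1 : Measurable (fun p : En n × En n => (-4 * ((‖p.1 - p.2‖ ^ 2 + e m) ^ 3)⁻¹)) := by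
        fun_prop
      exact (((m1.mul fcont.measurable).mul (ρc.measurable.comp measurable_snd)).mul
        (ρc.measurable.comp measurable_fst)).aestronglyMeasurable
    · filter_upwards [diag_ae hn] with p hp
      have := hepos m
      refine kbound _ _ _ (norm_pos_iff.2 (sub_ne_zero.2 hp)) ?_ (hL' _ _) p
      calc ‖p.1 - p.2‖ ^ 6 = (‖p.1 - p.2‖ ^ 2) ^ 3 := by ring
        _ ≤ _ := by gcongr; linarith
    · filter_upwards [diag_ae hn] with p hp
      have hr := norm_pos_iff.2 (sub_ne_zero.2 hp)
      refine Tendsto.mul_const _ (Tendsto.mul_const _ (Tendsto.mul_const _ ?_))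
      refine Tendsto.const_mul _ ?_
      have : (‖p.1 - p.2‖ ^ 6)⁻¹ = ((‖p.1 - p.2‖ ^ 2 + 0) ^ 3)⁻¹ := by ring
      rw [this]
      exact ((helim.const_add _).pow 3).inv₀ (by positivity)
  have main : 2 * ∫ p : En n × En n, (‖p.1 - p.2‖ ^ 4)⁻¹ * ρ p.2 * g p.1 ∂(volume.prod volume)
      = - ∫ p, K p ∂(volume.prod volume) := by
    refine tendsto_nhds_unique (lim1.const_mul 2) ?_
    refine lim2.neg.congr fun m => ?_
    exact (eps_identity (hepos m) ha hac hρ hρi).symm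
  have hWg : ∀ x, ∫ y, (‖x - y‖ ^ 4)⁻¹ * ρ y * g x = (∫ y, (‖x - y‖ ^ 4)⁻¹ * ρ y) * g x :=
    fun x => integral_mul_const _ _
  constructor
  · refine hP.integral_prod_left.congr (Filter.Eventually.of_forall fun x => ?_)
    exact hWg x
  · rw [integral_prod _ hP, integral_prod _ hKi] at main
    simp only [hWg] at main
    rw [main]
    congr 2
    ext x
    congr 1
    ext y
    simp only [hK]
    rw [inner_smul_right, inner_sub_left, gradient, gradient,
      InnerProductSpace.toDual_symm_apply, InnerProductSpace.toDual_symm_apply]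

end Nonlinear

section Time

variable {n : ℕ}

open Filter Topology

lemma slice_hasDerivAt {F : Type*} [NormedAddCommGroup F] [NormedSpace ℝ F] {H : ℝ × En n → F}
    (hH : Differentiable ℝ H) (s : ℝ) (x : En n) :
    HasDerivAt (fun s => H (s, x)) (fderiv ℝ H (s, x) (1, 0)) s :=
  (hH (s, x)).hasFDerivAt.comp_hasDerivAt s ((hasDerivAt_id s).prodMk (hasDerivAt_const s x))

lemma slice_DD {F : Type*} [NormedAddCommGroup F] [NormedSpace ℝ F] {H : ℝ × En n → F}
    (hH : Differentiable ℝ H) (s : ℝ) (x : En n) (j : Fin n) :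
    DD j (fun x => H (s, x)) x = fderiv ℝ H (s, x) (0, EuclideanSpace.single j 1) := by
  have := (hH (s, x)).hasFDerivAt.comp x ((hasFDerivAt_const s x).prodMk (hasFDerivAt_id x))
  unfold DD
  have h2 : HasFDerivAt (fun x => H (s, x)) _ x := this
  rw [h2.fderiv]
  simp

lemma deriv_param {H : ℝ × En n → ℂ} (hH : ContDiff ℝ 1 H) {K : Set (En n)}
    (hK : IsCompact K) (hHK : ∀ s x, x ∉ K → H (s, x) = 0) (t : ℝ) :
    HasDerivAt (fun s => ∫ x, H (s, x)) (∫ x, fderiv ℝ H (t, x) (1, 0)) t := by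
  have hd : Differentiable ℝ H := hH.differentiable (by simp)
  have hc' : Continuous (fun p => fderiv ℝ H p (1, 0)) :=
    (hH.continuous_fderiv (by simp)).clm_apply continuous_const
  have hz : ∀ s x, x ∉ K → fderiv ℝ H (s, x) (1, 0) = 0 := by
    intro s x hx
    have h1 := slice_hasDerivAt hd s x
    have h2 : (fun s => H (s, x)) = fun _ => 0 := funext fun s => hHK s x hx
    rw [h2] at h1
    exact h1.unique (hasDerivAt_const _ _)
  obtain ⟨C, hC⟩ := ((isCompact_Icc (a := t - 1) (b := t + 1)).prod hK).exists_bound_of_continuousOn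
    hc'.continuousOn
  refine (hasDerivAt_integral_of_dominated_loc_of_deriv_le (s := Icc (t - 1) (t + 1))
    (F := fun s x => H (s, x))
    (F' := fun s x => fderiv ℝ H (s, x) (1, 0)) (bound := K.indicator fun _ => C) ?_ ?_ ?_ ?_ ?_ ?_
    ?_).2
  · exact Icc_mem_nhds (by linarith) (by linarith)
  · exact Eventually.of_forall fun s => (hH.continuous.comp (by fun_prop)).aestronglyMeasurable
  · refine (hH.continuous.comp (by fun_prop : Continuous fun x : En n =>
      (t, x))).integrable_of_hasCompactSupport ?_
    exact HasCompactSupport.intro hK fun x hx => hHK t x hx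
  · exact (hc'.comp (by fun_prop : Continuous fun x : En n => (t, x))).aestronglyMeasurable
  · refine Eventually.of_forall fun x s hs => ?_
    by_cases hx : x ∈ K
    · rw [indicator_of_mem hx]; exact hC (s, x) ⟨hs, hx⟩
    · rw [hz s x hx]; simp [hx]
  · rw [integrable_indicator_iff hK.measurableSet]
    exact integrableOn_const hK.measure_lt_top.ne
  · exact Eventually.of_forall fun x s _ => slice_hasDerivAt hd s x

/-- Smooth truncation in time. -/
lemma exists_global {I : Set ℝ} {u : ℝ → En n → ℂ}
    (hu : ContDiffOn ℝ (⊤ : ℕ∞) (fun p : ℝ × En n => u p.1 p.2) (I ×ˢ Set.univ))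
    {t : ℝ} (ht : t ∈ interior I) :
    ∃ U : ℝ × En n → ℂ, ContDiff ℝ (⊤ : ℕ∞) U ∧ ∀ᶠ s in 𝓝 t, ∀ x, U (s, x) = u s x := by
  obtain ⟨r, hr, hrI⟩ := Metric.nhds_basis_closedBall.mem_iff.1 (isOpen_interior.mem_nhds ht)
  let χ : ContDiffBump t := ⟨r / 2, r, by positivity, by linarith⟩
  refine ⟨fun p => χ p.1 • u p.1 p.2, ?_, ?_⟩
  · rw [contDiff_iff_contDiffAt]
    rintro ⟨s, x⟩
    by_cases hs : s ∈ interior I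
    · have h1 : ContDiffAt ℝ (⊤ : ℕ∞) (fun p : ℝ × En n => u p.1 p.2) (s, x) := by
        refine hu.contDiffAt ?_
        exact prod_mem_nhds (mem_interior_iff_mem_nhds.1 hs) univ_mem
      exact (χ.contDiff.comp contDiff_fst).contDiffAt.smul h1
    · have h2 : s ∉ Metric.closedBall t r := fun h => hs (hrI h)
      have h3 : ∀ᶠ p : ℝ × En n in 𝓝 (s, x), p.1 ∉ Metric.closedBall t r :=
        (continuous_fst.tendsto (s, x)).eventually
          ((Metric.isClosed_closedBall (x := t) (ε := r)).isOpen_compl.mem_nhds h2)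
      refine (contDiffAt_const (c := (0 : ℂ))).congr_of_eventuallyEq ?_
      filter_upwards [h3] with p hp
      have : χ p.1 = 0 := χ.zero_of_le_dist (by
        have : ¬ dist p.1 t ≤ r := hp
        exact (not_le.1 this).le)
      simp [this]
  · filter_upwards [χ.eventuallyEq_one] with s hs x
    simp [hs]

lemma time_part {I : Set ℝ} {u : ℝ → En n → ℂ}
    (hu : ContDiffOn ℝ (⊤ : ℕ∞) (fun p : ℝ × En n => u p.1 p.2) (I ×ˢ Set.univ))
    {t : ℝ} (ht : t ∈ interior I) {a : En n → ℝ} (ha : ContDiff ℝ (⊤ : ℕ∞) a)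
    (hac : HasCompactSupport a) :
    ContDiff ℝ (⊤ : ℕ∞) (u t) ∧ ∃ w : En n → ℂ, ContDiff ℝ (⊤ : ℕ∞) w ∧
      (∀ x, w x = deriv (fun s => u s x) t) ∧
      HasDerivAt (fun s => ∫ x, (∑ j : Fin n, ((DD j a x : ℝ) : ℂ) * DD j (u s) x) *
            (starRingEnd ℂ) (u s x))
        (∫ x, ∑ j : Fin n, ((DD j a x : ℝ) : ℂ) * (DD j w x * (starRingEnd ℂ) (u t x)
            + DD j (u t) x * (starRingEnd ℂ) (w x))) t := by
  obtain ⟨U, hU, hUu⟩ := exists_global hu ht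
  have hUt : (fun x => U (t, x)) = u t := funext hUu.self_of_nhds
  have dU := hU.differentiable (by simp)
  have hfU : ContDiff ℝ (⊤ : ℕ∞) (fderiv ℝ U) := hU.fderiv_right (by simp)
  have dfU := hfU.differentiable (by simp)
  have sm : ContDiff ℝ (⊤ : ℕ∞) (fun x : En n => (t, x)) := by fun_prop
  have hut : ContDiff ℝ (⊤ : ℕ∞) (u t) := by rw [← hUt]; exact hU.comp sm
  set w : En n → ℂ := fun x => fderiv ℝ U (t, x) (1, 0) with hw
  refine ⟨hut, w, (hfU.comp sm).clm_apply contDiff_const, ?_, ?_⟩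
  · intro x
    have h1 := slice_hasDerivAt dU t x
    have h2 : (fun s => U (s, x)) =ᶠ[𝓝 t] fun s => u s x := by
      filter_upwards [hUu] with s hs using hs x
    exact ((h1.congr_of_eventuallyEq h2.symm).deriv).symm
  · set H : ℝ × En n → ℂ := fun p => (∑ j : Fin n, ((DD j a p.2 : ℝ) : ℂ) *
        fderiv ℝ U p (0, EuclideanSpace.single j 1)) * (starRingEnd ℂ) (U p) with hH
    have sH : ContDiff ℝ (⊤ : ℕ∞) H := by
      rw [hH]
      refine ContDiff.mul (ContDiff.sum fun j _ => ContDiff.mul ?_ ?_) ?_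
      · exact (smooth_ofReal (DD_smooth ha j)).comp contDiff_snd
      · exact hfU.clm_apply contDiff_const
      · exact Complex.conjCLE.toContinuousLinearMap.contDiff.comp hU
    have key := deriv_param (K := tsupport a) (sH.of_le (by norm_cast)) hac (by
      intro s x hx
      have : ∀ j, DD j a x = 0 := fun j => by
        have : fderiv ℝ a x = 0 := by
          by_contra h
          exact hx (support_fderiv_subset ℝ h)
        simp [DD, this]
      simp [hH, this]) t
    have e1 : (fun s => ∫ x, H (s, x)) =ᶠ[𝓝 t] (fun s => ∫ x, (∑ j : Fin n,
        ((DD j a x : ℝ) : ℂ) * DD j (u s) x) * (starRingEnd ℂ) (u s x)) := by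
      filter_upwards [hUu] with s hs
      have hs' : (fun x => U (s, x)) = u s := funext hs
      congr 1; ext x
      simp only [hH, hs]
      congr 1
      refine Finset.sum_congr rfl fun j _ => ?_
      rw [← slice_DD dU, hs']
    refine (key.congr_of_eventuallyEq e1.symm).congr_deriv ?_
    congr 1; ext x
    have d1 := slice_hasDerivAt (sH.differentiable (by simp)) t x
    refine d1.unique ?_
    have d2 : ∀ j : Fin n, HasDerivAt (fun s => fderiv ℝ U (s, x) (0, EuclideanSpace.single j 1))
        (DD j w x) t := by
      intro j
      have h := (slice_hasDerivAt dfU t x).clm_apply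
        (hasDerivAt_const t ((0, EuclideanSpace.single j 1) : ℝ × En n))
      refine h.congr_deriv ?_
      have hsy := (hU.contDiffAt (x := (t, x))).isSymmSndFDerivAt (by simp; norm_cast)
      have h5 : DD j w x = fderiv ℝ (fderiv ℝ U) (t, x) (0, EuclideanSpace.single j 1) (1, 0) := by
        rw [hw, slice_DD (H := fun p => fderiv ℝ U p (1, 0))
          (fun p => (dfU p).clm_apply (differentiableAt_const _)),
          fderiv_clm_apply (dfU _) (differentiableAt_const _)]
        simp
      rw [h5, hsy.eq]
      simp
    have d3 : HasDerivAt (fun s => (starRingEnd ℂ) (U (s, x))) ((starRingEnd ℂ) (w x)) t :=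
      Complex.conjCLE.toContinuousLinearMap.hasFDerivAt.comp_hasDerivAt t
        (slice_hasDerivAt dU t x)
    have d4 := (HasDerivAt.fun_sum (u := Finset.univ) fun j _ =>
      (d2 j).const_mul ((DD j a x : ℝ) : ℂ)).mul d3
    refine d4.congr_deriv ?_
    rw [Finset.sum_mul, Finset.sum_mul, ← Finset.sum_add_distrib]
    refine Finset.sum_congr rfl fun j _ => ?_
    rw [← slice_DD dU, hUt, hUu.self_of_nhds x]
    ring

end Time

section Assembly

variable {n : ℕ}

lemma lapR_eq {a : En n → ℝ} (ha : ContDiff ℝ (⊤ : ℕ∞) a) :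
    lapR a = fun x => ∑ j, DD j (DD j a) x := by
  ext x
  unfold lapR
  exact Finset.sum_congr rfl fun j _ => iter_two ha x j j

lemma lapC_eq {a : En n → ℂ} (ha : ContDiff ℝ (⊤ : ℕ∞) a) (x : En n) :
    lapC a x = ∑ j, DD j (DD j a) x := by
  unfold lapC
  exact Finset.sum_congr rfl fun j _ => iter_two ha x j j

lemma lapR_smooth {a : En n → ℝ} (ha : ContDiff ℝ (⊤ : ℕ∞) a) :
    ContDiff ℝ (⊤ : ℕ∞) (lapR a) := by
  rw [lapR_eq ha]
  exact ContDiff.sum fun j _ => DD_smooth (DD_smooth ha j) j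

lemma DD2_ofReal {a : En n → ℝ} (ha : ContDiff ℝ (⊤ : ℕ∞) a) (j k : Fin n) (x : En n) :
    DD j (DD k (fun y => (a y : ℂ))) x = ((DD j (DD k a) x : ℝ) : ℂ) := by
  have : DD k (fun y => (a y : ℂ)) = fun y => ((DD k a y : ℝ) : ℂ) :=
    funext fun y => DD_ofReal (smooth_diff ha) k y
  rw [this, DD_ofReal (smooth_diff (DD_smooth ha k))]

lemma lap_ofReal {a : En n → ℝ} (ha : ContDiff ℝ (⊤ : ℕ∞) a) (x : En n) :
    ∑ j, DD j (DD j (fun y => (a y : ℂ))) x = ((lapR a x : ℝ) : ℂ) := by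
  rw [lapR_eq ha]
  push_cast
  exact Finset.sum_congr rfl fun j _ => DD2_ofReal ha j j x

lemma lap_conj {f : En n → ℂ} (hf : ContDiff ℝ (⊤ : ℕ∞) f) (x : En n) :
    ∑ j, DD j (DD j (fun y => (starRingEnd ℂ) (f y))) x
      = (starRingEnd ℂ) (∑ j, DD j (DD j f) x) := by
  rw [map_sum]
  refine Finset.sum_congr rfl fun j _ => ?_
  have : DD j (fun y => (starRingEnd ℂ) (f y)) = fun y => (starRingEnd ℂ) (DD j f y) :=
    funext fun y => DD_conj (smooth_diff hf) j y
  rw [this, DD_conj (smooth_diff (DD_smooth hf j))]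

lemma scalar1 (d W : ℝ) (u w l : ℂ) (hw : Complex.I * w + l = W * u) :
    2 * (-(d : ℂ) * w * (starRingEnd ℂ) u).im
      = (-(d : ℂ) * (l * (starRingEnd ℂ) u + (starRingEnd ℂ) l * u)).re
        + 2 * (W * (d * ‖u‖ ^ 2)) := by
  have : w = Complex.I * (l - W * u) := by
    linear_combination (-Complex.I) * hw + w * Complex.I_mul_I
  rw [this, ← Complex.normSq_eq_norm_sq, Complex.normSq_apply]
  simp
  ring

lemma scalar2 (b W : ℝ) (u w l z : ℂ) (hw : Complex.I * w + l = W * u) :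
    2 * ((b : ℂ) * (z * (starRingEnd ℂ) w - w * (starRingEnd ℂ) z)).im
      = (-2 * ((b : ℂ) * (z * (starRingEnd ℂ) l + (starRingEnd ℂ) z * l))).re
        + 2 * (W * (b * (2 * (z * (starRingEnd ℂ) u).re))) := by
  have : w = Complex.I * (l - W * u) := by
    linear_combination (-Complex.I) * hw + w * Complex.I_mul_I
  rw [this]
  simp
  ring

lemma rho_DD {f : En n → ℂ} (hf : ContDiff ℝ (⊤ : ℕ∞) f) (j : Fin n) (x : En n) :
    DD j (fun y => ‖f y‖ ^ 2) x = 2 * (DD j f x * (starRingEnd ℂ) (f x)).re := by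
  have hs : ContDiff ℝ (⊤ : ℕ∞) (fun y => ‖f y‖ ^ 2) := hf.norm_sq ℝ
  have h1 := DD_ofReal (smooth_diff hs) j x
  have h2 : (fun y => ((‖f y‖ ^ 2 : ℝ) : ℂ)) = fun y => f y * (starRingEnd ℂ) (f y) := by
    ext y; rw [Complex.mul_conj, Complex.normSq_eq_norm_sq]
  rw [h2, DD_mul (smooth_diff hf) (smooth_diff (smooth_conj hf)), DD_conj (smooth_diff hf)] at h1
  have h3 := congrArg Complex.re h1
  rw [Complex.ofReal_re] at h3
  rw [← h3]
  simp; ring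

end Assembly

/-- Pointwise form of the identity. -/
lemma pointwise_identity {n : ℕ} {a : En n → ℝ} (ha : ContDiff ℝ (⊤ : ℕ∞) a) {f w : En n → ℂ}
    (hf : ContDiff ℝ (⊤ : ℕ∞) f) (hw : ContDiff ℝ (⊤ : ℕ∞) w) (x : En n) (W : ℝ)
    (heq : Complex.I * w x + ∑ k, DD k (DD k f) x = W * f x) :
    2 * (∑ j : Fin n, ((DD j a x : ℝ) : ℂ) * (DD j w x * (starRingEnd ℂ) (f x)
            + DD j f x * (starRingEnd ℂ) (w x))).im
      = 2 * (∑ j, DD j (fun y => ((DD j a y : ℝ) : ℂ) * (w y * (starRingEnd ℂ) (f y))) x).im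
        + (-((lapR a x : ℝ) : ℂ) * ((∑ k, DD k (DD k f) x) * (starRingEnd ℂ) (f x)
              + (starRingEnd ℂ) (∑ k, DD k (DD k f) x) * f x)
          - 2 * (∑ j, ((DD j a x : ℝ) : ℂ) * (DD j f x * (starRingEnd ℂ) (∑ k, DD k (DD k f) x)
            + (starRingEnd ℂ) (DD j f x) * (∑ k, DD k (DD k f) x)))).re
        + 2 * (W * (∑ j, DD j (fun z => DD j a z * ‖f z‖ ^ 2) x)) := by
  have hs : ContDiff ℝ (⊤ : ℕ∞) (fun y => ‖f y‖ ^ 2) := hf.norm_sq ℝ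
  set l := ∑ k, DD k (DD k f) x with hl
  have e1 : ∀ j, ((DD j a x : ℝ) : ℂ) * (DD j w x * (starRingEnd ℂ) (f x)
            + DD j f x * (starRingEnd ℂ) (w x))
      = DD j (fun y => ((DD j a y : ℝ) : ℂ) * (w y * (starRingEnd ℂ) (f y))) x
        + -((DD j (DD j a) x : ℝ) : ℂ) * w x * (starRingEnd ℂ) (f x)
        + ((DD j a x : ℝ) : ℂ) * (DD j f x * (starRingEnd ℂ) (w x)
            - w x * (starRingEnd ℂ) (DD j f x)) := by
    intro j
    rw [DD_mul (smooth_diff (smooth_ofReal (DD_smooth ha j)))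
      (smooth_diff (hw.mul (smooth_conj hf))), DD_mul (smooth_diff hw)
      (smooth_diff (smooth_conj hf)), DD_conj (smooth_diff hf),
      DD_ofReal (smooth_diff (DD_smooth ha j))]
    ring
  have e2 : ∀ j, DD j (fun z => DD j a z * ‖f z‖ ^ 2) x
      = DD j (DD j a) x * ‖f x‖ ^ 2 + DD j a x * (2 * (DD j f x * (starRingEnd ℂ) (f x)).re) := by
    intro j
    rw [DD_mulR (smooth_diff (DD_smooth ha j)) (smooth_diff hs), rho_DD hf]
  have e3 : lapR a x = ∑ j, DD j (DD j a) x := by rw [lapR_eq ha]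
  simp only [e1, e2, Finset.sum_add_distrib, Complex.add_im, ← Finset.sum_mul]
  rw [← e3, Finset.sum_neg_distrib, ← Complex.ofReal_sum, ← e3]
  have s1 := scalar1 (lapR a x) W (f x) (w x) l heq
  have s2 := Finset.sum_congr rfl fun j (_ : j ∈ Finset.univ) =>
    scalar2 (DD j a x) W (f x) (w x) l (DD j f x) heq
  rw [Finset.sum_add_distrib, ← Finset.mul_sum, ← Finset.mul_sum, ← Finset.mul_sum,
    ← Complex.im_sum, ← Complex.re_sum, ← Finset.mul_sum] at s2
  rw [Complex.sub_re]
  have s3 : ∀ z : ℂ, (-2 * z).re = - (2 * z).re := fun z => by simp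
  rw [s3] at s2
  linarith

/-- Virial-type identity (second derivative): the Morawetz identity for the weight `a`,
with the Hartree kernel gradient `∇V(z) = -4 ‖z‖⁻⁶ z`. -/
theorem virial_second_derivative (n : ℕ) (hn : 5 ≤ n) (I : Set ℝ) (hI : I.OrdConnected)
    (u : ℝ → En n → ℂ) (hu : IsHartreeSolution n I u)
    (a : En n → ℝ) (ha : ContDiff ℝ (⊤ : ℕ∞) a) (ha' : HasCompactSupport a) :
    ∀ t ∈ interior I,
      HasDerivAt (fun s => 2 * (∫ x, (∑ j : Fin n,
              (fderiv ℝ a x (EuclideanSpace.single j 1) : ℂ) *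
                fderiv ℝ (u s) x (EuclideanSpace.single j 1)) *
            (starRingEnd ℂ) (u s x)).im)
        (-(∫ x, lapR (lapR a) x * ‖u t x‖ ^ 2)
          + 4 * (∫ x, ∑ j : Fin n, ∑ k : Fin n,
              (iteratedFDeriv ℝ 2 a x ![EuclideanSpace.single j 1, EuclideanSpace.single k 1] : ℂ) *
                fderiv ℝ (fun y => (starRingEnd ℂ) (u t y)) x (EuclideanSpace.single j 1) *
                fderiv ℝ (u t) x (EuclideanSpace.single k 1)).re
          - ∫ x, ∫ y,
              ⟪gradient a x - gradient a y, (-4 * (‖x - y‖ ^ 6)⁻¹) • (x - y)⟫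
                * ‖u t y‖ ^ 2 * ‖u t x‖ ^ 2) t := by
  intro t ht
  have htI := interior_subset ht
  obtain ⟨hf, w, hw, hwd, hder⟩ := time_part hu.smooth ht ha ha'
  set f := u t with hfdef
  obtain ⟨φ, hφ⟩ := hu.schwartz t htI
  have hs : ContDiff ℝ (⊤ : ℕ∞) (fun y => ‖f y‖ ^ 2) := hf.norm_sq ℝ
  have hfi : Integrable f := by rw [hfdef, ← hφ]; exact φ.integrable
  obtain ⟨B, hB⟩ : ∃ B, ∀ x, ‖f x‖ ≤ B := by
    obtain ⟨C, hC⟩ := φ.decay 0 0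
    exact ⟨C, fun x => by rw [hfdef, ← hφ]; simpa using hC.2 x⟩
  have hρB : ∀ x, ‖‖f x‖ ^ 2‖ ≤ B ^ 2 := fun x => by
    rw [Real.norm_of_nonneg (by positivity)]
    exact pow_le_pow_left₀ (norm_nonneg _) (hB x) 2
  have hρi : Integrable (fun y => ‖f y‖ ^ 2) := by
    refine (hfi.norm.mul_const B).mono' hs.continuous.aestronglyMeasurable
      (Filter.Eventually.of_forall fun x => ?_)
    rw [Real.norm_of_nonneg (by positivity), pow_two]
    gcongr
    exact hB x
  obtain ⟨hWi, hW⟩ := nonlinear_part hn ha ha' hs hρi hρB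
  have hA := smooth_ofReal ha
  have hAc : HasCompactSupport (fun y => (a y : ℂ)) := ha'.comp_left (g := Complex.ofReal) (by simp)
  obtain ⟨r, hri, hr0, hr⟩ := linear_part hA hAc hf (smooth_conj hf)
  have heq : ∀ x, Complex.I * w x + ∑ k, DD k (DD k f) x
      = (hartreePotential f x : ℂ) * f x := by
    intro x
    rw [hwd, ← lapC_eq hf]
    exact hu.eqn t htI x
  -- the divergence term
  set G : Fin n → En n → ℂ := fun j y => ((DD j a y : ℝ) : ℂ) * (w y * (starRingEnd ℂ) (f y))
    with hG
  have sG : ∀ j, ContDiff ℝ (⊤ : ℕ∞) (G j) := fun j =>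
    (smooth_ofReal (DD_smooth ha j)).mul (hw.mul (smooth_conj hf))
  have cDa : ∀ j, HasCompactSupport (fun y => ((DD j a y : ℝ) : ℂ)) := fun j =>
    (DD_support ha' j).comp_left (g := Complex.ofReal) (by simp)
  have cG : ∀ j, HasCompactSupport (G j) := fun j => (cDa j).mul_right
  have iG : ∀ j, Integrable (DD j (G j)) := fun j =>
    integrable_smooth (DD_smooth (sG j) j) (DD_support (cG j) j)
  have iGs : Integrable (fun x => ∑ j, DD j (G j) x) := integrable_finsetSum _ fun j _ => iG j
  have zG : ∫ x, ∑ j, DD j (G j) x = 0 := by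
    rw [integral_finsetSum _ fun j _ => iG j]
    exact Finset.sum_eq_zero fun j _ => integral_DD_zero (sG j) (cG j) j
  -- the second-derivative term
  set T : En n → ℂ := fun x => ∑ j : Fin n, ∑ k : Fin n,
      (iteratedFDeriv ℝ 2 a x ![EuclideanSpace.single j 1, EuclideanSpace.single k 1] : ℂ) *
        fderiv ℝ (fun y => (starRingEnd ℂ) (f y)) x (EuclideanSpace.single j 1) *
        fderiv ℝ f x (EuclideanSpace.single k 1) with hT
  have hTe : T = fun x => ∑ j, ∑ k, DD j (DD k (fun y => (a y : ℂ))) x *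
      DD j (fun y => (starRingEnd ℂ) (f y)) x * DD k f x := by
    ext x
    refine Finset.sum_congr rfl fun j _ => Finset.sum_congr rfl fun k _ => ?_
    rw [iter_two ha, DD2_ofReal ha]
    rfl
  have iT : Integrable T := by
    rw [hTe]
    refine integrable_finsetSum _ fun j _ => integrable_finsetSum _ fun k _ => ?_
    refine integrable_smooth (((DD_smooth (DD_smooth hA k) j).mul
      (DD_smooth (smooth_conj hf) j)).mul (DD_smooth hf k)) ?_
    exact ((DD_support (DD_support hAc k) j).mul_right).mul_right
  -- the bilaplacian term
  have sL : ContDiff ℝ (⊤ : ℕ∞) (lapR (lapR a)) := lapR_smooth (lapR_smooth ha)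
  have cL : HasCompactSupport (lapR (lapR a)) := by
    have key : ∀ b : En n → ℝ, ContDiff ℝ (⊤ : ℕ∞) b → HasCompactSupport b →
        HasCompactSupport (lapR b) := by
      intro b hb hc
      refine HasCompactSupport.intro (K := tsupport b) hc fun x hx => ?_
      rw [lapR_eq hb]
      refine Finset.sum_eq_zero fun j _ => ?_
      refine image_eq_zero_of_notMem_tsupport fun h => hx ?_
      have h1 : ∀ g : En n → ℝ, tsupport (DD j g) ⊆ tsupport g := fun g =>
        closure_minimal (fun y hy => support_fderiv_subset ℝ (fun h0 => hy (by
          change (fderiv ℝ g y) _ = 0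
          rw [h0]; rfl))) (isClosed_tsupport g)
      exact h1 _ (h1 _ h)
    exact key _ (lapR_smooth ha) (key _ ha ha')
  have iL : Integrable (fun x => lapR (lapR a) x * ‖f x‖ ^ 2) :=
    integrable_smooth (sL.mul hs) cL.mul_right
  set S : En n → ℂ := fun x => ∑ j : Fin n, ((DD j a x : ℝ) : ℂ) *
    (DD j w x * (starRingEnd ℂ) (f x) + DD j f x * (starRingEnd ℂ) (w x)) with hS
  have iS : Integrable S := by
    refine integrable_finsetSum _ fun j _ => ?_
    exact integrable_smooth ((smooth_ofReal (DD_smooth ha j)).mul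
      (((DD_smooth hw j).mul (smooth_conj hf)).add ((DD_smooth hf j).mul (smooth_conj hw))))
      (cDa j).mul_right
  have pw : ∀ x, 2 * (S x).im = 2 * (∑ j, DD j (G j) x).im
      + (-(lapR (lapR a) x * ‖f x‖ ^ 2) + 4 * (T x).re + (r x).re)
      + 2 * (hartreePotential f x * (∑ j, DD j (fun z => DD j a z * ‖f z‖ ^ 2) x)) := by
    intro x
    rw [hS, pointwise_identity ha hf hw x _ (heq x)]
    congr 2
    have h1 := congrArg Complex.re (hr x)
    simp only [lap_ofReal ha, lap_ofReal (lapR_smooth ha), lap_conj hf, DD_ofReal (smooth_diff ha),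
      DD_conj (smooth_diff hf)] at h1
    rw [h1, hTe]
    simp only [DD_conj (smooth_diff hf), Complex.mul_conj, Complex.normSq_eq_norm_sq]
    rw [Complex.add_re, Complex.add_re]
    congr 2
    · rw [← Complex.ofReal_neg, ← Complex.ofReal_mul, Complex.ofReal_re]; ring
    · simp
  have hfin : HasDerivAt (fun s => 2 * (∫ x, (∑ j : Fin n, ((DD j a x : ℝ) : ℂ) * DD j (u s) x) *
            (starRingEnd ℂ) (u s x)).im) (2 * (∫ x, S x).im) t :=
    (Complex.imCLM.hasFDerivAt.comp_hasDerivAt t hder).const_mul 2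
  refine hfin.congr_deriv ?_
  have him : ∀ g : En n → ℂ, Integrable g → (∫ x, g x).im = ∫ x, (g x).im := fun g hg =>
    (Complex.imCLM.integral_comp_comm hg).symm
  have hre : ∀ g : En n → ℂ, Integrable g → (∫ x, g x).re = ∫ x, (g x).re := fun g hg =>
    (Complex.reCLM.integral_comp_comm hg).symm
  have j1 : Integrable (fun x => 2 * (∑ j, DD j (G j) x).im) := iGs.im.const_mul 2
  have j2 : Integrable (fun x => -(lapR (lapR a) x * ‖f x‖ ^ 2)) := iL.neg
  have j3 : Integrable (fun x => 4 * (T x).re) := iT.re.const_mul 4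
  have j4 : Integrable (fun x => (r x).re) := hri.re
  have j5 : Integrable (fun x => 2 * (hartreePotential f x *
      (∑ j, DD j (fun z => DD j a z * ‖f z‖ ^ 2) x))) := hWi.const_mul 2
  have j23 : Integrable (fun x => -(lapR (lapR a) x * ‖f x‖ ^ 2) + 4 * (T x).re) := j2.add j3
  have j234 : Integrable (fun x => -(lapR (lapR a) x * ‖f x‖ ^ 2) + 4 * (T x).re + (r x).re) :=
    j23.add j4
  have j1234 : Integrable (fun x => 2 * (∑ j, DD j (G j) x).im
      + (-(lapR (lapR a) x * ‖f x‖ ^ 2) + 4 * (T x).re + (r x).re)) := j1.add j234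
  rw [him S iS, ← integral_const_mul, integral_congr_ae (Filter.Eventually.of_forall pw),
    integral_add j1234 j5, integral_add j1 j234,
    integral_add j23 j4, integral_add j2 j3, integral_const_mul, integral_const_mul,
    integral_const_mul, integral_neg, ← him _ iGs, zG, ← hre r hri, hr0, ← hre T iT]
  have hW' : 2 * ∫ x, hartreePotential f x * (∑ j, DD j (fun z => DD j a z * ‖f z‖ ^ 2) x)
    = _ := hW
  rw [hW']
  simp only [Complex.zero_im, Complex.zero_re]
  ring

end
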